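/- Let c₁, c₂ be reals with c₁ ≠ 0, let I = {u : c₁·u + c₂ > 0}, let u₀ ∈ I, and let g : ℝ → ℝ be differentiable with g'(u) ≠ 0 for all u ∈ I and g(u) = (c₁·u + c₂)·g'(u) for all u ∈ I. Then g(u) = g(u₀)·( (c₁u + c₂)/(c₁u₀ + c₂) )^{1/c₁} for all u ∈ I; in particular g has the form g(u) = k₁·(u + k₂)^{k₃} on I with k₂ = c₂/c₁ and k₃ = 1/c₁. -/

import Mathlib

/-- If `g` is differentiable with nonvanishing derivative on `I = {u : c₁u + c₂ > 0}`
and `g = (c₁u + c₂) g'` on `I` with `c₁ ≠ 0`, then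
`g(u) = g(u₀) ((c₁u + c₂)/(c₁u₀ + c₂))^{1/c₁}` on `I`; in particular `g` is a power
law `g(u) = k₁ (u + k₂)^{k₃}` on `I` with `k₂ = c₂/c₁` and `k₃ = 1/c₁`. -/
theorem diffusion_power_of_ratio_linear
    (c₁ c₂ : ℝ) (hc₁ : c₁ ≠ 0) (u₀ : ℝ) (hu₀ : 0 < c₁ * u₀ + c₂)
    (g : ℝ → ℝ) (hg : Differentiable ℝ g)
    (hg' : ∀ u : ℝ, 0 < c₁ * u + c₂ → deriv g u ≠ 0)
    (heq : ∀ u : ℝ, 0 < c₁ * u + c₂ → g u = (c₁ * u + c₂) * deriv g u) :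
    (∀ u : ℝ, 0 < c₁ * u + c₂ →
        g u = g u₀ * ((c₁ * u + c₂) / (c₁ * u₀ + c₂)) ^ (1 / c₁)) ∧
      ∃ k₁ : ℝ, ∀ u : ℝ, 0 < c₁ * u + c₂ →
        g u = k₁ * (u + c₂ / c₁) ^ (1 / c₁) := by
  set S : Set ℝ := {u | 0 < c₁ * u + c₂} with hS
  have hSo : IsOpen S := isOpen_lt continuous_const (by fun_prop)
  have hSc : Convex ℝ S := by
    intro x hx y hy a b ha hb hab
    simp only [hS, Set.mem_ofPred_eq, smul_eq_mul] at *
    have e : c₁ * (a * x + b * y) + c₂ = a * (c₁ * x + c₂) + b * (c₁ * y + c₂) := by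
      linear_combination (-c₂) * hab
    rw [e]
    rcases ha.eq_or_lt with h | h
    · have : b = 1 := by linarith
      subst this; subst h; linarith
    · have := mul_pos h hx
      have := mul_nonneg hb hy.le
      linarith
  set h : ℝ → ℝ := fun u => g u * (c₁ * u + c₂) ^ (-(1 / c₁)) with hh
  have hder : ∀ u ∈ S, HasDerivAt h 0 u := by
    intro u hu
    have hu' : 0 < c₁ * u + c₂ := hu
    have h1 : HasDerivAt (fun u : ℝ => c₁ * u + c₂) c₁ u := by
      simpa using ((hasDerivAt_id u).const_mul c₁).add_const c₂
    have h2 := (hg u).hasDerivAt.mul (h1.rpow_const (p := -(1 / c₁)) (Or.inl hu'.ne'))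
    refine h2.congr_deriv ?_
    have e : (c₁ * u + c₂) ^ (-(1 / c₁)) = (c₁ * u + c₂) ^ (-(1 / c₁) - 1) * (c₁ * u + c₂) := by
      rw [← Real.rpow_add_one hu'.ne']; congr 1; ring
    rw [heq u hu', e]
    field_simp
    ring
  have hconst : ∀ u ∈ S, h u = h u₀ := fun u hu =>
    hSo.is_const_of_deriv_eq_zero hSc.isPreconnected
      (fun x hx => (hder x hx).differentiableAt.differentiableWithinAt)
      (fun x hx => (hder x hx).deriv) hu hu₀
  have hform : ∀ u : ℝ, 0 < c₁ * u + c₂ → g u = h u₀ * (c₁ * u + c₂) ^ (1 / c₁) := by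
    intro u hu
    rw [← hconst u hu]
    simp only [hh]
    rw [mul_assoc, ← Real.rpow_add hu]
    simp
  refine ⟨?_, ?_⟩
  · intro u hu
    rw [hform u hu, hform u₀ hu₀, Real.div_rpow hu.le hu₀.le]
    have := (Real.rpow_pos_of_pos hu₀ (1 / c₁)).ne'
    field_simp
  rcases lt_or_gt_of_ne hc₁ with hneg | hpos
  · -- for negative `c₁` the function would blow up at the boundary point of `I`
    exfalso
    have hp : 0 < -(1 / c₁) := by
      have := one_div_neg.mpr hneg
      linarith
    have hcont : Continuous h :=
      hg.continuous.mul ((by fun_prop : Continuous fun u : ℝ => c₁ * u + c₂).rpow_const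
        (fun _ => Or.inr hp.le))
    have hb : h (-c₂ / c₁) = 0 := by
      have : c₁ * (-c₂ / c₁) + c₂ = 0 := by field_simp; ring
      simp only [hh]
      rw [this, Real.zero_rpow hp.ne', mul_zero]
    have hcl : -c₂ / c₁ ∈ closure S := by
      have : S = Set.Iio (-c₂ / c₁) := by
        ext u
        simp only [hS, Set.mem_ofPred_eq, Set.mem_Iio, lt_div_iff_of_neg hneg]
        constructor <;> intro h <;> linarith
      rw [this, closure_Iio]
      exact Set.self_mem_Iic
    have hcl2 : closure S ⊆ {u | h u = h u₀} :=
      closure_minimal hconst (isClosed_eq hcont continuous_const)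
    have h0 : h u₀ = 0 := by
      have : h (-c₂ / c₁) = h u₀ := hcl2 hcl
      rw [← this, hb]
    have hg0 := hform u₀ hu₀
    rw [h0, zero_mul, heq u₀ hu₀] at hg0
    exact (mul_ne_zero hu₀.ne' (hg' u₀ hu₀)) hg0
  · refine ⟨h u₀ * c₁ ^ (1 / c₁), fun u hu => ?_⟩
    have e : c₁ * u + c₂ = c₁ * (u + c₂ / c₁) := by field_simp
    have hpos' : 0 < u + c₂ / c₁ := by
      rw [e] at hu
      exact (mul_pos_iff_of_pos_left hpos).mp hu
    rw [hform u hu, e, Real.mul_rpow hpos.le hpos'.le]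
    ring
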